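/- Let X be a random variable taking values in a finite type 𝒳, let T : 𝒳 → ℝ^D be a deterministic function, and set Z = T(X), so Z has a probability mass function P_Z supported on finitely many points of ℝ^D. Then for every σ > 0, the mutual information satisfies the differentiable relaxed lower bound I(X;Z) ≥ −log ( E_{z, z' iid ∼ P_Z}[ exp( −‖z − z'‖² / (2σ²) ) ] ). -/

import Mathlib

open scoped BigOperators Classical

/-- PMF of `Z = T(X) ∈ ℝ^D`, the pushforward of the PMF `p` of `X` under the
deterministic map `T`; it is supported on the finite image of `T`. -/
noncomputable def pushPMF {𝒳 : Type*} [Fintype 𝒳] {D : ℕ}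
    (p : 𝒳 → ℝ) (T : 𝒳 → EuclideanSpace ℝ (Fin D)) (z : EuclideanSpace ℝ (Fin D)) : ℝ :=
  ∑ x, if T x = z then p x else 0

/-- Shannon entropy (natural log) of `Z = T(X)`, summed over the finite support
`Finset.image T Finset.univ ⊆ ℝ^D`. -/
noncomputable def entropyZ {𝒳 : Type*} [Fintype 𝒳] {D : ℕ}
    (p : 𝒳 → ℝ) (T : 𝒳 → EuclideanSpace ℝ (Fin D)) : ℝ :=
  ∑ z ∈ Finset.image T Finset.univ, -(pushPMF p T z * Real.log (pushPMF p T z))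

/-- Conditional entropy `H(Z | X)` when `Z = T(X)`: given `X = x`, the conditional
distribution of `Z` is the point mass at `T x`. -/
noncomputable def condEntropyZ {𝒳 : Type*} [Fintype 𝒳] {D : ℕ}
    (p : 𝒳 → ℝ) (T : 𝒳 → EuclideanSpace ℝ (Fin D)) : ℝ :=
  ∑ x, p x * ∑ z ∈ Finset.image T Finset.univ,
    -((if T x = z then (1 : ℝ) else 0) * Real.log (if T x = z then (1 : ℝ) else 0))

/-- Mutual information `I(X ; Z) = H(Z) - H(Z | X)` when `Z = T(X)`. -/
noncomputable def mutualInfoZ {𝒳 : Type*} [Fintype 𝒳] {D : ℕ}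
    (p : 𝒳 → ℝ) (T : 𝒳 → EuclideanSpace ℝ (Fin D)) : ℝ :=
  entropyZ p T - condEntropyZ p T

theorem pushPMF_nonneg {𝒳 : Type*} [Fintype 𝒳] {D : ℕ} {p : 𝒳 → ℝ} (hp : ∀ x, 0 ≤ p x)
    (T : 𝒳 → EuclideanSpace ℝ (Fin D)) (z : EuclideanSpace ℝ (Fin D)) : 0 ≤ pushPMF p T z :=
  Finset.sum_nonneg fun x _ => by split_ifs <;> simp [hp x]

theorem sum_pushPMF {𝒳 : Type*} [Fintype 𝒳] {D : ℕ} (p : 𝒳 → ℝ)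
    (T : 𝒳 → EuclideanSpace ℝ (Fin D)) :
    ∑ z ∈ Finset.image T Finset.univ, pushPMF p T z = ∑ x, p x := by
  unfold pushPMF
  rw [Finset.sum_comm]
  refine Finset.sum_congr rfl fun x _ => ?_
  rw [Finset.sum_ite_eq, if_pos (Finset.mem_image_of_mem T (Finset.mem_univ x))]

/-- A deterministic function of `X` has no conditional entropy given `X`. -/
theorem condEntropyZ_eq_zero {𝒳 : Type*} [Fintype 𝒳] {D : ℕ} (p : 𝒳 → ℝ)
    (T : 𝒳 → EuclideanSpace ℝ (Fin D)) : condEntropyZ p T = 0 := by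
  refine Finset.sum_eq_zero fun x _ => ?_
  rw [Finset.sum_eq_zero, mul_zero]
  intro z _
  split_ifs <;> simp

/-- Jensen's inequality for `log`, with a majorant `K` of the weights `w`: the negative entropy
`∑ w log w` is at most `log ∑ w K`. -/
theorem sum_mul_log_le_log_sum_mul {ι : Type*} (s : Finset ι) (w K : ι → ℝ)
    (hw : ∀ i ∈ s, 0 ≤ w i) (hw1 : ∑ i ∈ s, w i = 1) (hK : ∀ i ∈ s, w i ≤ K i) :
    ∑ i ∈ s, w i * Real.log (w i) ≤ Real.log (∑ i ∈ s, w i * K i) := by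
  set S := ∑ i ∈ s, w i * K i with hS
  have hS0 : 0 < S := by
    obtain ⟨i, hi, hwi⟩ : ∃ i ∈ s, 0 < w i :=
      (Finset.sum_pos_iff_of_nonneg hw).1 (hw1 ▸ one_pos)
    exact Finset.sum_pos' (fun j hj => mul_nonneg (hw j hj) ((hw j hj).trans (hK j hj)))
      ⟨i, hi, mul_pos hwi (hwi.trans_le (hK i hi))⟩
  calc ∑ i ∈ s, w i * Real.log (w i)
      ≤ ∑ i ∈ s, (w i * K i / S - w i + w i * Real.log S) := by
        refine Finset.sum_le_sum fun i hi => ?_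
        rcases (hw i hi).eq_or_lt with h0 | hpos
        · simp [← h0]
        have hKi : 0 < K i := hpos.trans_le (hK i hi)
        have hlog := Real.log_le_sub_one_of_pos (div_pos hKi hS0)
        rw [Real.log_div hKi.ne' hS0.ne'] at hlog
        have hlog' : Real.log (w i) ≤ K i / S - 1 + Real.log S := by
          linarith [Real.log_le_log hpos (hK i hi)]
        calc w i * Real.log (w i) ≤ w i * (K i / S - 1 + Real.log S) := by gcongr
          _ = w i * K i / S - w i + w i * Real.log S := by ring
    _ = Real.log S := by
        rw [Finset.sum_add_distrib, Finset.sum_sub_distrib, ← Finset.sum_div, ← hS,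
          ← Finset.sum_mul, hw1, div_self hS0.ne']
        ring

/-- For `X` with PMF `p` on a finite type, `Z = T(X)` with
`T : 𝒳 → ℝ^D` deterministic, and any `σ > 0`, the mutual information admits the
differentiable relaxed lower bound
`I(X;Z) ≥ -log ( E_{z, z' iid ∼ P_Z}[ exp(-‖z - z'‖² / (2σ²)) ] )`. -/
theorem mutualInfo_ge_neg_log_expected_gaussianKernel {𝒳 : Type*} [Fintype 𝒳] {D : ℕ}
    (p : 𝒳 → ℝ) (hp0 : ∀ x, 0 ≤ p x) (hp1 : ∑ x, p x = 1)
    (T : 𝒳 → EuclideanSpace ℝ (Fin D)) (σ : ℝ) (hσ : 0 < σ) :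
    mutualInfoZ p T ≥
      -Real.log (∑ z ∈ Finset.image T Finset.univ, ∑ z' ∈ Finset.image T Finset.univ,
        pushPMF p T z * pushPMF p T z' * Real.exp (-‖z - z'‖ ^ 2 / (2 * σ ^ 2))) := by
  rw [mutualInfoZ, condEntropyZ_eq_zero, sub_zero, entropyZ, Finset.sum_neg_distrib, ge_iff_le,
    neg_le_neg_iff]
  simp_rw [mul_assoc, ← Finset.mul_sum]
  refine sum_mul_log_le_log_sum_mul _ _ _ (fun z _ => pushPMF_nonneg hp0 T z)
    ((sum_pushPMF p T).trans hp1) fun z hz => ?_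
  have hle := Finset.single_le_sum
    (f := fun z' => pushPMF p T z' * Real.exp (-‖z - z'‖ ^ 2 / (2 * σ ^ 2)))
    (fun z' _ => mul_nonneg (pushPMF_nonneg hp0 T z') (Real.exp_nonneg _)) hz
  simpa using hle
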